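/- Let A be a finite alphabet, X ⊆ A^ℤ a subshift, and d ≥ 1 an integer such that the lower entropy dimension of X satisfies D(X) < 1/d. Let F ⊆ Aut(X) be a finite set and f ∈ ⟨F⟩ an element such that for some constant K > 0 one has ‖f^n‖_F ≤ K·(log n)^d for all n ≥ 2. Then f is periodic, i.e., f^m = id for some integer m ≥ 1. -/

import Mathlib

/-- The word norm of `g` with respect to the generating set `F`:
the least `n` such that `g` is a product of `n` elements of `F ∪ F⁻¹`. -/
noncomputable def wordNorm {G : Type*} [Group G] (F : Set G) (g : G) : ℕ :=
  sInf {n : ℕ | ∃ w : List G, w.length = n ∧ (∀ x ∈ w, x ∈ F ∨ x⁻¹ ∈ F) ∧ w.prod = g}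
/-- The shift map on the full shift `A^ℤ`. -/
def shiftMap (A : Type*) : (ℤ → A) → (ℤ → A) := fun x i => x (i + 1)

/-- A subshift: a closed, shift-invariant subset of `A^ℤ`. -/
def IsSubshift {A : Type*} [TopologicalSpace A] (X : Set (ℤ → A)) : Prop :=
  IsClosed X ∧ shiftMap A '' X = X

/-- The automorphism group of the full shift `A^ℤ`, as the set of those permutations of
`A^ℤ` which are homeomorphisms commuting with the shift. -/
def FullShiftAut (A : Type*) [TopologicalSpace A] : Set (Equiv.Perm (ℤ → A)) :=
  {f | Continuous f ∧ Continuous f.symm ∧ ∀ x, f (shiftMap A x) = shiftMap A (f x)}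

/-- The automorphism group of a subshift `X ⊆ A^ℤ`, as the set of those permutations of
`X` which are homeomorphisms (for the subspace topology) commuting with the shift. -/
def SubshiftAut {A : Type*} [TopologicalSpace A] (X : Set (ℤ → A)) :
    Set (Equiv.Perm X) :=
  {f | Continuous f ∧ Continuous f.symm ∧
    ∀ x y : X, (y : ℤ → A) = shiftMap A (x : ℤ → A) →
      ((f y : X) : ℤ → A) = shiftMap A ((f x : X) : ℤ → A)}

/-- The number of words of length `k` appearing in elements of `X`. -/
noncomputable def wordCount {A : Type*} (X : Set (ℤ → A)) (k : ℕ) : ℕ :=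
  Set.ncard {w : Fin k → A | ∃ x ∈ X, ∃ i : ℤ, ∀ j : Fin k, x (i + (j : ℤ)) = w j}

/-- The lower entropy dimension of a subshift,
`liminf_k log (log N_k(X)) / log k` (base-2 logarithms). -/
noncomputable def lowerEntropyDim {A : Type*} (X : Set (ℤ → A)) : ℝ :=
  Filter.liminf
    (fun k : ℕ => Real.logb 2 (Real.logb 2 (wordCount X k)) / Real.logb 2 k)
    Filter.atTop

namespace SubshiftAut

section Radius

variable {A : Type*} {X : Set (ℤ → A)}

/-- `g` has radius `R` if the value of `g x` at `i` depends only on `x` in `[i - R, i + R]`. -/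
def HasRadius (g : Equiv.Perm X) (R : ℕ) : Prop :=
  ∀ (x y : X) (i : ℤ), (∀ j, |j - i| ≤ (R : ℤ) → (x : ℤ → A) j = (y : ℤ → A) j) →
    (g x : ℤ → A) i = (g y : ℤ → A) i

lemma HasRadius.mono {g : Equiv.Perm X} {R S : ℕ} (h : HasRadius g R) (hRS : R ≤ S) :
    HasRadius g S := fun x y i hxy => h x y i fun j hj => hxy j (hj.trans (by exact_mod_cast hRS))

lemma HasRadius.one : HasRadius (1 : Equiv.Perm X) 0 := fun x y i hxy => hxy i (by simp)

lemma HasRadius.mul {g h : Equiv.Perm X} {R S : ℕ} (hg : HasRadius g R) (hh : HasRadius h S) :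
    HasRadius (g * h) (R + S) := by
  intro x y i hxy
  refine hg _ _ i fun j hj => hh _ _ j fun k hk => hxy k ?_
  have := abs_sub_le k j i
  push_cast
  linarith

lemma HasRadius.list_prod {R : ℕ} (w : List (Equiv.Perm X)) (hw : ∀ g ∈ w, HasRadius g R) :
    HasRadius w.prod (R * w.length) := by
  induction w with
  | nil => simpa using HasRadius.one
  | cons g w ih =>
    rw [List.prod_cons]
    refine ((hw g (by simp)).mul (ih fun h hh => hw h (by simp [hh]))).mono ?_
    simp only [List.length_cons]
    linarith

end Radius

section Automorphisms

variable {A : Type*} [TopologicalSpace A] {X : Set (ℤ → A)}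

/-- A subshift is invariant under every integer translation. -/
lemma translate_mem (hX : IsSubshift X) {x : ℤ → A} (hx : x ∈ X) (i : ℤ) :
    (fun j => x (j + i)) ∈ X := by
  induction i using Int.induction_on with
  | zero => simpa using hx
  | succ i ih =>
    rw [← hX.2]
    refine ⟨_, ih, ?_⟩
    funext j
    simp only [shiftMap]
    ring_nf
  | pred i ih =>
    rw [← hX.2] at ih
    obtain ⟨z, hz, hzx⟩ := ih
    convert hz using 1
    funext j
    have := congrFun hzx (j - 1)
    simp only [shiftMap, sub_add_cancel] at this
    rw [this]
    ring_nf

/-- An automorphism commutes with every integer translation. -/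
lemma apply_translate (hX : IsSubshift X) {g : Equiv.Perm X} (hg : g ∈ SubshiftAut X)
    (x : X) (i : ℤ) :
    (g ⟨fun j => (x : ℤ → A) (j + i), translate_mem hX x.2 i⟩ : ℤ → A) =
      fun j => (g x : ℤ → A) (j + i) := by
  induction i using Int.induction_on with
  | zero => simp
  | succ i ih =>
    have h := hg.2.2 ⟨fun j => (x : ℤ → A) (j + i), translate_mem hX x.2 i⟩
      ⟨fun j => (x : ℤ → A) (j + (i + 1)), translate_mem hX x.2 (i + 1)⟩ (by
        funext j
        simp only [shiftMap]
        ring_nf)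
    rw [h, ih]
    funext j
    simp only [shiftMap]
    ring_nf
  | pred i ih =>
    have h := hg.2.2 ⟨fun j => (x : ℤ → A) (j + (-i - 1)), translate_mem hX x.2 (-i - 1)⟩
      ⟨fun j => (x : ℤ → A) (j + -i), translate_mem hX x.2 (-i)⟩ (by
        funext j
        simp only [shiftMap]
        ring_nf)
    rw [ih] at h
    funext j
    have := congrFun h (j - 1)
    simp only [shiftMap, sub_add_cancel] at this
    rw [← this]
    ring_nf

lemma inv_mem {g : Equiv.Perm X} (hg : g ∈ SubshiftAut X) (hX : IsSubshift X) :
    g⁻¹ ∈ SubshiftAut X := by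
  refine ⟨hg.2.1, hg.1, fun x y hxy => ?_⟩
  have hy : y = g ⟨fun j => (g⁻¹ x : ℤ → A) (j + 1), translate_mem hX (g⁻¹ x).2 1⟩ := by
    apply Subtype.ext
    rw [apply_translate hX hg, hxy]
    simp
    rfl
  rw [hy, Equiv.Perm.inv_def, Equiv.symm_apply_apply]
  rfl

lemma mem_of_mem_closure (hX : IsSubshift X) {F : Set (Equiv.Perm X)} (hF : F ⊆ SubshiftAut X)
    {g : Equiv.Perm X} (hg : g ∈ Subgroup.closure F) : g ∈ SubshiftAut X := by
  induction hg using Subgroup.closure_induction with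
  | mem g hg => exact hF hg
  | one => exact ⟨continuous_id, continuous_id, fun _ _ h => h⟩
  | mul g h _ _ hg hh =>
    exact ⟨hg.1.comp hh.1, hh.2.1.comp hg.2.1, fun x y hxy => hg.2.2 _ _ (hh.2.2 _ _ hxy)⟩
  | inv g _ hg => exact inv_mem hg hX

/-- The Curtis–Hedlund–Lyndon theorem: automorphisms have finite radius. -/
lemma exists_hasRadius [DiscreteTopology A] [Finite A] (hX : IsSubshift X)
    {g : Equiv.Perm X} (hg : g ∈ SubshiftAut X) : ∃ R, HasRadius g R := by
  have : CompactSpace X := isCompact_iff_compactSpace.mp hX.1.isCompact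
  have hc : Continuous fun x : X => (g x : ℤ → A) 0 :=
    (continuous_apply 0).comp (continuous_subtype_val.comp hg.1)
  have hcoord (j : ℤ) : Continuous fun x : X => (x : ℤ → A) j :=
    (continuous_apply j).comp continuous_subtype_val
  suffices h : ∃ R : ℕ, ∀ x y : X, (∀ j, |j| ≤ (R : ℤ) → (x : ℤ → A) j = (y : ℤ → A) j) →
      (g x : ℤ → A) 0 = (g y : ℤ → A) 0 by
    obtain ⟨R, hR⟩ := h
    refine ⟨R, fun x y i hxy => ?_⟩
    have := hR ⟨_, translate_mem hX x.2 i⟩ ⟨_, translate_mem hX y.2 i⟩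
      fun j hj => hxy (j + i) (by simpa using hj)
    simpa [apply_translate hX hg] using this
  by_contra! hcon
  let C : ℕ → Set (X × X) := fun R =>
    {p | (g p.1 : ℤ → A) 0 ≠ (g p.2 : ℤ → A) 0} ∩
      ⋂ j : ℤ, ⋂ _ : |j| ≤ (R : ℤ), {p | (p.1 : ℤ → A) j = (p.2 : ℤ → A) j}
  have hclosed (R : ℕ) : IsClosed (C R) := by
    refine IsClosed.inter ?_ (isClosed_iInter fun j => isClosed_iInter fun _ =>
      isClosed_eq ((hcoord j).comp continuous_fst) ((hcoord j).comp continuous_snd))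
    exact (isClosed_discrete {q : A × A | q.1 ≠ q.2}).preimage
      ((hc.comp continuous_fst).prodMk (hc.comp continuous_snd))
  have hne : (⋂ R, C R).Nonempty := by
    refine IsCompact.nonempty_iInter_of_sequence_nonempty_isCompact_isClosed C ?_ ?_
      (hclosed 0).isCompact hclosed
    · intro R p hp
      refine ⟨hp.1, ?_⟩
      have h2 := hp.2
      simp only [Set.mem_iInter] at h2 ⊢
      exact fun j hj => h2 j (hj.trans (by push_cast; linarith))
    · intro R
      obtain ⟨x, y, hxy, hgxy⟩ := hcon R
      refine ⟨(x, y), hgxy, ?_⟩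
      simp only [Set.mem_iInter]
      exact hxy
  obtain ⟨⟨x, y⟩, hxy⟩ := hne
  rw [Set.mem_iInter] at hxy
  have hxy_eq : x = y := by
    apply Subtype.ext
    funext j
    have h2 := (hxy j.natAbs).2
    simp only [Set.mem_iInter] at h2
    exact h2 j (by simp)
  exact (hxy 0).1 (by rw [hxy_eq])

/-- Radii of elements of a finitely generated group of automorphisms grow at most linearly
in the word norm. -/
lemma exists_hasRadius_wordNorm [DiscreteTopology A] [Finite A] (hX : IsSubshift X)
    (F : Finset (Equiv.Perm X)) (hF : ↑F ⊆ SubshiftAut X) :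
    ∃ R : ℕ, ∀ g ∈ Subgroup.closure (F : Set (Equiv.Perm X)),
      HasRadius g (R * wordNorm (F : Set (Equiv.Perm X)) g) := by
  have hrad : ∀ g : Equiv.Perm X, ∃ R, g ∈ F → HasRadius g R ∧ HasRadius g⁻¹ R := by
    intro g
    by_cases hg : g ∈ F
    · obtain ⟨R, hR⟩ := exists_hasRadius hX (hF hg)
      obtain ⟨S, hS⟩ := exists_hasRadius hX (inv_mem (hF hg) hX)
      exact ⟨max R S, fun _ => ⟨hR.mono (le_max_left _ _), hS.mono (le_max_right _ _)⟩⟩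
    · exact ⟨0, fun h => absurd h hg⟩
  choose r hr using hrad
  refine ⟨F.sup r, fun g hg => ?_⟩
  obtain ⟨l, hl, hlg⟩ : ∃ l : List (Equiv.Perm X),
      (∀ x ∈ l, x ∈ (F : Set (Equiv.Perm X)) ∨ x⁻¹ ∈ (F : Set (Equiv.Perm X))) ∧ l.prod = g := by
    rw [← Subgroup.mem_toSubmonoid, Subgroup.closure_toSubmonoid] at hg
    exact Submonoid.exists_list_of_mem_closure hg
  obtain ⟨w, hlen, hw, hwg⟩ := Nat.sInf_mem (s := {n : ℕ | ∃ w : List (Equiv.Perm X),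
    w.length = n ∧ (∀ x ∈ w, x ∈ (F : Set (Equiv.Perm X)) ∨ x⁻¹ ∈ (F : Set (Equiv.Perm X))) ∧
      w.prod = g}) ⟨l.length, l, rfl, hl, hlg⟩
  have hprod := HasRadius.list_prod (R := F.sup r) w fun h hh => by
    rcases hw h hh with hF' | hF'
    · exact (hr h hF').1.mono (Finset.le_sup (f := r) hF')
    · have := (hr _ hF').2.mono (Finset.le_sup (f := r) hF')
      rwa [inv_inv] at this
  rw [hwg, hlen] at hprod
  exact hprod

end Automorphisms

end SubshiftAut

/-- A self-surjection of a set, observed through a finite-valued function whose traces of some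
length `N` take fewer than `N` values, is uniformly periodic as far as the observation can see
(a form of the Morse–Hedlund theorem). -/
lemma exists_periodic_of_ncard_trace_lt {Z A : Type*} [Finite A] (f : Equiv.Perm Z) (φ : Z → A)
    (N : ℕ) (hN : (Set.range fun (z : Z) (n : Fin N) => φ ((f ^ (n : ℕ)) z)).ncard < N) :
    ∃ p : ℕ, 1 ≤ p ∧ ∀ z, φ ((f ^ p) z) = φ z := by
  let T : (m : ℕ) → Z → Fin m → A := fun m z n => φ ((f ^ (n : ℕ)) z)
  have hT : ∀ m z, T m z = fun n : Fin m => φ ((f ^ (n : ℕ)) z) := fun _ _ => rfl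
  obtain ⟨m, hm⟩ : ∃ m, (Set.range (T (m + 1))).ncard ≤ (Set.range (T m)).ncard := by
    by_contra! hlt
    have hge : ∀ m, m ≤ (Set.range (T m)).ncard := by
      intro m
      induction m with
      | zero => exact Nat.zero_le _
      | succ m ih => exact Nat.succ_le_of_lt (ih.trans_lt (hlt m))
    exact absurd hN (not_lt.mpr (hge N))
  have hres : Set.range (T m) = (fun t : Fin (m + 1) → A => t ∘ Fin.castSucc) ''
      Set.range (T (m + 1)) := by
    rw [← Set.range_comp]
    rfl
  have hinj : Set.InjOn (fun t : Fin (m + 1) → A => t ∘ Fin.castSucc) (Set.range (T (m + 1))) := by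
    refine Set.injOn_of_ncard_image_eq (le_antisymm (Set.ncard_image_le (Set.toFinite _)) ?_)
      (Set.toFinite _)
    rwa [← hres]
  have hdet : ∀ z z', T m z = T m z' → T (m + 1) z = T (m + 1) z' := fun z z' h =>
    hinj ⟨z, rfl⟩ ⟨z', rfl⟩ h
  have hstep : ∀ z z', T m z = T m z' → T m (f z) = T m (f z') := by
    intro z z' h
    funext n
    have := congrFun (hdet z z' h) n.succ
    simpa [hT, pow_succ] using this
  choose s hs using fun t : Set.range (T m) => t.2
  let S : Set.range (T m) → Set.range (T m) := fun t => ⟨T m (f (s t)), f (s t), rfl⟩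
  let q : Z → Set.range (T m) := fun z => ⟨T m z, z, rfl⟩
  have hSq : ∀ z, S (q z) = q (f z) := fun z => Subtype.ext (hstep _ _ (hs (q z)))
  have hsurj : Function.Surjective S := by
    rintro ⟨_, z, rfl⟩
    exact ⟨q (f.symm z), by rw [hSq]; simp [q]⟩
  let e : Equiv.Perm (Set.range (T m)) :=
    Equiv.ofBijective S ⟨Finite.injective_iff_surjective.mpr hsurj, hsurj⟩
  have heq : ∀ n z, (e ^ n) (q z) = q ((f ^ n) z) := by
    intro n z
    induction n with
    | zero => simp
    | succ n ih =>
      rw [pow_succ', pow_succ', Equiv.Perm.mul_apply, Equiv.Perm.mul_apply, ih]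
      exact hSq _
  refine ⟨orderOf e, orderOf_pos e, fun z => ?_⟩
  have h := heq (orderOf e) z
  rw [pow_orderOf_eq_one, Equiv.Perm.one_apply] at h
  have h0 := congrFun (hdet _ _ (congrArg Subtype.val h)) 0
  simpa [hT] using h0.symm

/-- If all powers `f ^ n` with `n ≤ N_k(X)` have radius `r` with `2 r + 1 ≤ k`, then `f` is
periodic. -/
lemma SubshiftAut.exists_pow_eq_one {A : Type*} [TopologicalSpace A] [Finite A]
    {X : Set (ℤ → A)} (hX : IsSubshift X) {f : Equiv.Perm X}
    (hcomm : ∀ n : ℕ, f ^ n ∈ SubshiftAut X) {k r : ℕ} (hrk : 2 * r + 1 ≤ k)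
    (hrad : ∀ n ≤ wordCount X k, HasRadius (f ^ n) r) :
    ∃ m : ℕ, 1 ≤ m ∧ f ^ m = 1 := by
  rcases isEmpty_or_nonempty X with _ | _
  · exact ⟨1, le_rfl, Subsingleton.elim _ _⟩
  obtain ⟨p, hp, hper⟩ := exists_periodic_of_ncard_trace_lt f (fun x : X => (x : ℤ → A) 0)
    (wordCount X k + 1) (by
      let W : X → Fin k → A := fun x j => (x : ℤ → A) (-r + (j : ℤ))
      let T : X → Fin (wordCount X k + 1) → A := fun x n => ((f ^ (n : ℕ)) x : ℤ → A) 0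
      have hTW : ∀ x y, W x = W y → T x = T y := by
        intro x y h
        funext n
        refine hrad n (Nat.lt_succ_iff.mp n.2) x y 0 fun j hj => ?_
        rw [sub_zero, abs_le] at hj
        have := congrFun h ⟨(j + r).toNat, by omega⟩
        simp only [W] at this
        rwa [show (-(r : ℤ) + ((j + r).toNat : ℤ)) = j by omega] at this
      obtain ⟨u, hu⟩ : ∃ u, T = u ∘ W := ⟨fun w => T (Function.invFun W w), by
        funext x
        exact hTW _ _ (Function.invFun_eq (f := W) ⟨x, rfl⟩).symm⟩
      refine Nat.lt_succ_of_le ?_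
      change (Set.range T).ncard ≤ _
      rw [hu, Set.range_comp]
      refine (Set.ncard_image_le (Set.toFinite _)).trans (Set.ncard_le_ncard ?_ (Set.toFinite _))
      rintro _ ⟨x, rfl⟩
      exact ⟨x, x.2, -r, fun j => rfl⟩)
  refine ⟨p, hp, Equiv.ext fun x => Subtype.ext (funext fun i => ?_)⟩
  have := hper ⟨_, translate_mem hX x.2 i⟩
  simpa [apply_translate hX (hcomm p)] using this

lemma wordCount_le_card_pow {A : Type*} [Fintype A] (X : Set (ℤ → A)) (k : ℕ) :
    wordCount X k ≤ Fintype.card A ^ k := by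
  refine (Set.ncard_le_card _).trans ?_
  simp [Nat.card_eq_fintype_card]

lemma one_le_logb_two_natCast {n : ℕ} (hn : 2 ≤ n) : 1 ≤ Real.logb 2 n := by
  rw [Real.le_logb_iff_rpow_le (by norm_num) (by positivity)]
  simpa using (by exact_mod_cast hn : (2 : ℝ) ≤ n)

/-- The quantity whose lower limit is the lower entropy dimension is bounded above. -/
lemma isBoundedUnder_le_entropyQuotient {A : Type*} [Fintype A] (X : Set (ℤ → A)) :
    Filter.IsBoundedUnder (· ≤ ·) Filter.atTop
      fun k : ℕ => Real.logb 2 (Real.logb 2 (wordCount X k)) / Real.logb 2 k := by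
  set c : ℕ := Fintype.card A + 1 with hc
  have hc1 : (1 : ℝ) ≤ c := by simp [hc]
  have hlogc : 0 ≤ Real.logb 2 c := Real.logb_nonneg (by norm_num) hc1
  refine Filter.isBoundedUnder_of_eventually_le (a := Real.logb 2 c + 1) ?_
  filter_upwards [Filter.eventually_ge_atTop 2] with k hk
  have hk1 := one_le_logb_two_natCast hk
  have hk0 : (0 : ℝ) < k := by positivity
  rw [div_le_iff₀ (by linarith)]
  rcases lt_or_ge (wordCount X k) 2 with hN | hN
  · have : Real.logb 2 (wordCount X k) = 0 := by
      interval_cases wordCount X k <;> simp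
    rw [this, Real.logb_zero]
    positivity
  have hN1 := one_le_logb_two_natCast hN
  have hle : Real.logb 2 (wordCount X k) ≤ c * k := by
    rw [Real.logb_le_iff_le_rpow (by norm_num) (by positivity)]
    have h1 : wordCount X k ≤ 2 ^ (c * k) := by
      refine (wordCount_le_card_pow X k).trans ?_
      rw [pow_mul]
      refine Nat.pow_le_pow_left ?_ k
      exact ((Nat.le_succ _).trans Nat.lt_two_pow_self.le)
    calc (wordCount X k : ℝ) ≤ ((2 ^ (c * k) : ℕ) : ℝ) := by exact_mod_cast h1
      _ = (2 : ℝ) ^ ((c : ℝ) * k) := by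
        rw [← Nat.cast_mul, Real.rpow_natCast]
        push_cast
        rfl
  calc Real.logb 2 (Real.logb 2 (wordCount X k)) ≤ Real.logb 2 (c * k) :=
        Real.logb_le_logb_of_le (by norm_num) (by linarith) hle
    _ = Real.logb 2 c + Real.logb 2 k := Real.logb_mul (by linarith) hk0.ne'
    _ ≤ (Real.logb 2 c + 1) * Real.logb 2 k := by nlinarith

/-- If the lower entropy dimension is less than `a`, then `N_k(X) ≤ 2 ^ (k ^ a)` for
arbitrarily large `k`. -/
lemma frequently_logb_wordCount_le {A : Type*} [Fintype A] (X : Set (ℤ → A)) {a : ℝ}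
    (ha : lowerEntropyDim X < a) :
    ∃ᶠ k : ℕ in Filter.atTop, Real.logb 2 (wordCount X k) ≤ (k : ℝ) ^ a := by
  have h := Filter.frequently_lt_of_liminf_lt
    (isBoundedUnder_le_entropyQuotient X).isCoboundedUnder_ge ha
  refine (h.and_eventually (Filter.eventually_ge_atTop 2)).mono fun k ⟨hlt, hk⟩ => ?_
  have hk1 := one_le_logb_two_natCast hk
  have hk0 : (0 : ℝ) < k := by positivity
  rcases lt_or_ge (wordCount X k) 2 with hN | hN
  · have : Real.logb 2 (wordCount X k) = 0 := by
      interval_cases wordCount X k <;> simp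
    rw [this]
    positivity
  have hN1 := one_le_logb_two_natCast hN
  rw [div_lt_iff₀ (by linarith), ← Real.logb_rpow_eq_mul_logb_of_pos hk0] at hlt
  exact ((Real.logb_lt_logb_iff (by norm_num) (by linarith) (by positivity)).mp hlt).le

/-- Sublinear powers are eventually dominated by the identity. -/
lemma eventually_mul_rpow_add_one_le {b : ℝ} (hb0 : 0 ≤ b) (hb : b < 1) (C : ℝ) :
    ∀ᶠ k : ℕ in Filter.atTop, C * (k : ℝ) ^ b + 1 ≤ k := by
  have ht : Filter.Tendsto (fun k : ℕ => (k : ℝ) ^ (1 - b)) Filter.atTop Filter.atTop :=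
    (tendsto_rpow_atTop (by linarith)).comp tendsto_natCast_atTop_atTop
  filter_upwards [ht.eventually_ge_atTop (C + 1), Filter.eventually_ge_atTop 1] with k hk hk1
  have hk1' : (1 : ℝ) ≤ k := by exact_mod_cast hk1
  have hp : 1 ≤ (k : ℝ) ^ b := Real.one_le_rpow hk1' hb0
  have hmul : (k : ℝ) ^ b * (k : ℝ) ^ (1 - b) = k := by
    rw [← Real.rpow_add (by linarith)]
    simp
  nlinarith

/-- **Lemma.** Let `X` be a subshift with lower entropy dimension less than `1/d`.
If `f ∈ ⟨F⟩ ≤ Aut(X)` satisfies `‖f^n‖_F ≤ K·(log₂ n)^d` for all `n ≥ 2`, then `f` is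
periodic. -/
theorem low_complexity_no_distortion (A : Type) [TopologicalSpace A] [DiscreteTopology A]
    [Fintype A] (X : Set (ℤ → A)) (hX : IsSubshift X) (d : ℕ) (hd : 1 ≤ d)
    (hdim : lowerEntropyDim X < 1 / (d : ℝ))
    (F : Finset (Equiv.Perm X)) (hF : ↑F ⊆ SubshiftAut X)
    (f : Equiv.Perm X) (hf : f ∈ Subgroup.closure (F : Set (Equiv.Perm X)))
    (K : ℝ) (hK : 0 < K)
    (hnorm : ∀ n : ℕ, 2 ≤ n →
      (wordNorm (F : Set (Equiv.Perm X)) (f ^ n) : ℝ) ≤ K * (Real.logb 2 n) ^ d) :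
    ∃ m : ℕ, 1 ≤ m ∧ f ^ m = 1 := by
  obtain ⟨R, hR⟩ := SubshiftAut.exists_hasRadius_wordNorm hX F hF
  have hpow (n : ℕ) : f ^ n ∈ Subgroup.closure (F : Set (Equiv.Perm X)) := pow_mem hf n
  have hd0 : (0 : ℝ) < d := by exact_mod_cast hd
  obtain ⟨a, ha, had⟩ := exists_between (max_lt hdim (one_div_pos.mpr hd0))
  obtain ⟨hdima, ha0⟩ := max_lt_iff.mp ha
  have had1 : a * d < 1 := (lt_div_iff₀ hd0).mp had
  obtain ⟨k, hk, hk1, hbig, hf1⟩ := ((frequently_logb_wordCount_le X hdima).and_eventually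
    ((Filter.eventually_ge_atTop 1).and
      ((eventually_mul_rpow_add_one_le (by positivity) had1 (2 * R * K)).and
        (Filter.eventually_ge_atTop
          (2 * (R * wordNorm (F : Set (Equiv.Perm X)) f) + 1))))).exists
  refine SubshiftAut.exists_pow_eq_one hX
    (fun n => SubshiftAut.mem_of_mem_closure hX hF (hpow n)) (k := k) (r := (k - 1) / 2)
    (by omega) fun n hn => ?_
  rcases Nat.lt_or_ge n 2 with hn2 | hn2
  · interval_cases n
    · exact SubshiftAut.HasRadius.one.mono (Nat.zero_le _)
    · rw [pow_one]
      exact (hR f hf).mono (by omega)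
  refine (hR _ (hpow n)).mono ?_
  have hlog : Real.logb 2 n ≤ (k : ℝ) ^ a :=
    (Real.logb_le_logb_of_le (by norm_num) (by positivity) (by exact_mod_cast hn)).trans hk
  have hlogd : Real.logb 2 n ^ d ≤ (k : ℝ) ^ (a * d) := by
    rw [Real.rpow_mul (by positivity), Real.rpow_natCast]
    exact pow_le_pow_left₀ (zero_le_one.trans (one_le_logb_two_natCast hn2)) hlog d
  have hreal : (2 * (R * wordNorm (F : Set (Equiv.Perm X)) (f ^ n)) + 1 : ℝ) ≤ k := by
    calc (2 * (R * wordNorm (F : Set (Equiv.Perm X)) (f ^ n)) + 1 : ℝ)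
        ≤ 2 * (R * (K * (k : ℝ) ^ (a * d))) + 1 := by
          gcongr
          exact (hnorm n hn2).trans (by gcongr)
      _ = 2 * R * K * (k : ℝ) ^ (a * d) + 1 := by ring
      _ ≤ k := hbig
  have hnat : 2 * (R * wordNorm (F : Set (Equiv.Perm X)) (f ^ n)) + 1 ≤ k := by
    exact_mod_cast hreal
  omega
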